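/- arXiv:2209.06374 — 3 statements merged into one kernel-verified Lean document; each statement's English description precedes it below -/
import Mathlib

section
/- Let V be a real vector space and let p, q : V → V be arbitrary functions (standing for the proximal operators prox_f and prox_g). Define T : V³ → V³ by T(x₁, x₂, x₃) = (x₁', x₂', x₃') where x₁' = p(x₃), x₂' = q(2x₁' − x₃), x₃' = x₃ + x₂' − x₁' (the update map of Algorithm 6), and define S : V² → V² by S(ξ₁, ξ₂) = (ξ₁', ξ₂') where ξ₁' = q(−ξ₁ + 2ξ₂) + ξ₁ − ξ₂ and ξ₂' = p(ξ₁') (the update map of Algorithm 7). Then the map h : V³ → V² given by h(x₁, x₂, x₃) = (x₃, p(x₃)) satisfies h ∘ T = S ∘ h. Consequently, if (x₁^k, x₂^k, x₃^k) are the iterates of Algorithm 6, then the sequence (ξ₁^k, ξ₂^k) := (x₃^k, x₁^{k+1}) is exactly the orbit of Algorithm 7 started from (x₃⁰, x₁¹), establishing the shift equivalence ξ₁^k = x₃^k, ξ₂^k = x₁^{k+1}. -/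
/-- With arbitrary functions `p, q : V → V` in place of `prox_f, prox_g`, the update map `T`
of Algorithm 6 is semi-conjugated to the update map `S` of Algorithm 7 by
`h(x₁,x₂,x₃) = (x₃, p x₃)`; consequently the iterates of Algorithm 6 produce, via the shift
`(ξ₁^k, ξ₂^k) = (x₃^k, x₁^{k+1})`, exactly the orbit of Algorithm 7 started at `(x₃⁰, x₁¹)`. -/
theorem algo6_algo7_shift_equivalence (V : Type*) [AddCommGroup V] [Module ℝ V]
    (p q : V → V) :
    let T : V × V × V → V × V × V := fun x =>
      let x₁' := p x.2.2
      let x₂' := q (2 • x₁' - x.2.2)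
      (x₁', x₂', x.2.2 + x₂' - x₁')
    let S : V × V → V × V := fun ξ =>
      let ξ₁' := q (-ξ.1 + 2 • ξ.2) + ξ.1 - ξ.2
      (ξ₁', p ξ₁')
    let h : V × V × V → V × V := fun x => (x.2.2, p x.2.2)
    h ∘ T = S ∘ h ∧
      ∀ x : ℕ → V × V × V, (∀ k : ℕ, x (k + 1) = T (x k)) →
        ∀ k : ℕ, ((x k).2.2, (x (k + 1)).1) = S^[k] ((x 0).2.2, (x 1).1) := by
  intro T S h
  have semiconj : Function.Semiconj h T S := by
    intro x
    have key : (T x).2.2 = (S (h x)).1 := by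
      change x.2.2 + q (2 • p x.2.2 - x.2.2) - p x.2.2 =
        q (-x.2.2 + 2 • p x.2.2) + x.2.2 - p x.2.2
      rw [neg_add_eq_sub, add_comm x.2.2]
    exact Prod.ext key (congrArg p key)
  refine ⟨semiconj.comp_eq, fun x hx k => ?_⟩
  have shift (k : ℕ) : ((x k).2.2, (x (k + 1)).1) = h (x k) := by rw [hx k]
  have orbit : x k = T^[k] (x 0) := by
    induction k with
    | zero => rfl
    | succ k ih => rw [hx k, ih, Function.iterate_succ_apply']
  rw [shift k, shift 0, orbit]
  exact (semiconj.iterate_right k).eq (x 0)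
end

section
/- Let f(x) = x², so ∇f(x) = 2x, and let S : ℝ² → ℝ² be the update map of Algorithm 2: S(ξ₁, ξ₂) = (ξ₁ − ξ₂ − (2/5)ξ₁, ξ₂ + (1/5)ξ₁) = ((3/5)ξ₁ − ξ₂, (1/5)ξ₁ + ξ₂). Then for every initial condition (ξ₁⁰, ξ₂⁰) ∈ ℝ², the sequence of iterates S^[k](ξ₁⁰, ξ₂⁰) converges to (0, 0) as k → ∞. -/
open Filter

/-- A real sequence whose squares are bounded by a geometric sequence of ratio `4 / 5`
tends to zero. -/
theorem tendsto_zero_of_sq_le_geometric {u : ℕ → ℝ} {C : ℝ}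
    (h : ∀ k, u k ^ 2 ≤ (4 / 5) ^ k * C) : Tendsto u atTop (nhds 0) := by
  have hgeom : Tendsto (fun k : ℕ => (4 / 5 : ℝ) ^ k * C) atTop (nhds 0) := by
    simpa using (tendsto_pow_atTop_nhds_zero_of_lt_one (r := (4 / 5 : ℝ))
      (by norm_num) (by norm_num)).mul_const C
  have hsq : Tendsto (fun k => u k ^ 2) atTop (nhds 0) :=
    squeeze_zero (fun k => sq_nonneg _) h hgeom
  have hsqrt := (Real.continuous_sqrt.tendsto 0).comp hsq
  rw [Real.sqrt_zero] at hsqrt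
  refine (tendsto_zero_iff_abs_tendsto_zero u).2 (hsqrt.congr fun k => ?_)
  exact Real.sqrt_sq_eq_abs (u k)

/-- With `f(x) = x²` (so `∇f(x) = 2x`), the Algorithm 2 update map
`S(ξ₁,ξ₂) = ((3/5)ξ₁ − ξ₂, (1/5)ξ₁ + ξ₂)` drives every initial condition to `(0,0)`. -/
theorem algo2_quadratic_converges :
    let S : ℝ × ℝ → ℝ × ℝ := fun ξ => ((3 / 5) * ξ.1 - ξ.2, (1 / 5) * ξ.1 + ξ.2)
    ∀ ξ₀ : ℝ × ℝ, Tendsto (fun k : ℕ => S^[k] ξ₀) atTop (nhds (0, 0)) := by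
  intro S ξ₀
  -- the quadratic form `V` is scaled by exactly `4 / 5` at each step
  let V : ℝ × ℝ → ℝ := fun ξ => (ξ.1 + ξ.2) ^ 2 + 4 * ξ.2 ^ 2
  have hV : ∀ k, V (S^[k] ξ₀) = (4 / 5) ^ k * V ξ₀ := by
    intro k
    induction k with
    | zero => simp
    | succ k ih =>
      have hstep : ∀ ξ, V (S ξ) = 4 / 5 * V ξ := fun ξ => by
        simp only [V, S]
        ring
      rw [Function.iterate_succ_apply', hstep, ih]
      ring
  have hfst : ∀ ξ, ξ.1 ^ 2 ≤ 2 * V ξ := fun ξ => by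
    simp only [V]
    nlinarith [sq_nonneg (ξ.1 + 2 * ξ.2), sq_nonneg ξ.2]
  have hsnd : ∀ ξ, ξ.2 ^ 2 ≤ 2 * V ξ := fun ξ => by
    simp only [V]
    nlinarith [sq_nonneg (ξ.1 + ξ.2), sq_nonneg ξ.2]
  refine Tendsto.prodMk_nhds
    (tendsto_zero_of_sq_le_geometric (C := 2 * V ξ₀) fun k => ?_)
    (tendsto_zero_of_sq_le_geometric (C := 2 * V ξ₀) fun k => ?_)
  · exact (hfst _).trans_eq (by rw [hV]; ring)
  · exact (hsnd _).trans_eq (by rw [hV]; ring)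
end

section
/- Let f(x) = x², so ∇f(x) = 2x, and let T : ℝ² → ℝ² be the update map of Algorithm 3: T(x₁, x₂) = ((13/5)x₁ − (6/5)x₂, x₁). Then: (i) for every initial condition (x₁⁰, x₂⁰), the observable h(x₁, x₂) = −x₁ + 2x₂ evaluated along the orbit satisfies h(T^[k](x₁⁰, x₂⁰)) = (3/5)^k · h(x₁⁰, x₂⁰), and in particular converges to 0; (ii) there exists an initial condition (x₁⁰, x₂⁰) whose orbit is unbounded, i.e., ‖T^[k](x₁⁰, x₂⁰)‖ → ∞ as k → ∞ (for instance the eigenvector direction (2, 1), along which T^[k](2,1) = 2^k · (2,1)). -/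
open Filter

/-- With `f(x) = x²` (so `∇f(x) = 2x`), the Algorithm 3 update map
`T(x₁,x₂) = ((13/5)x₁ − (6/5)x₂, x₁)` satisfies:
(i) the semi-conjugating observable `h(x₁,x₂) = −x₁ + 2x₂` decays along every orbit as
`(3/5)^k · h(x⁰)` (in particular it tends to `0`); and
(ii) some initial condition has an unbounded orbit, `‖T^[k] x⁰‖ → ∞`. -/
theorem algo3_quadratic_semiconjugate_decay_and_unbounded :
    let T : ℝ × ℝ → ℝ × ℝ := fun x => ((13 / 5) * x.1 - (6 / 5) * x.2, x.1)
    let h : ℝ × ℝ → ℝ := fun x => -x.1 + 2 * x.2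
    (∀ (x₀ : ℝ × ℝ) (k : ℕ), h (T^[k] x₀) = (3 / 5 : ℝ) ^ k * h x₀) ∧
      (∀ x₀ : ℝ × ℝ, Tendsto (fun k : ℕ => h (T^[k] x₀)) atTop (nhds 0)) ∧
      ∃ x₀ : ℝ × ℝ, Tendsto (fun k : ℕ => ‖T^[k] x₀‖) atTop atTop := by
  intro T h
  have h_T (x : ℝ × ℝ) : h (T x) = 3 / 5 * h x := by
    simp only [h, T]
    ring
  have h_iterate (x₀ : ℝ × ℝ) (k : ℕ) : h (T^[k] x₀) = (3 / 5 : ℝ) ^ k * h x₀ := by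
    induction k with
    | zero => simp
    | succ k ih => rw [Function.iterate_succ_apply', h_T, ih, pow_succ']; ring
  have iterate_eigenvector (k : ℕ) : T^[k] (2, 1) = (2 : ℝ) ^ k • ((2, 1) : ℝ × ℝ) := by
    induction k with
    | zero => simp
    | succ k ih =>
      rw [Function.iterate_succ_apply', ih]
      ext <;> simp only [T, Prod.smul_mk, smul_eq_mul] <;> ring
  refine ⟨h_iterate, fun x₀ => ?_, (2, 1), ?_⟩
  · simp only [h_iterate]
    simpa using (tendsto_pow_atTop_nhds_zero_of_lt_one (r := (3 / 5 : ℝ))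
      (by norm_num) (by norm_num)).mul_const (h x₀)
  · simp only [iterate_eigenvector, norm_smul, norm_pow, Real.norm_ofNat]
    exact (tendsto_pow_atTop_atTop_of_one_lt one_lt_two).atTop_mul_const
      (norm_pos_iff.mpr (by simp))
end
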